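/- arXiv:2601.19541 — 3 statements merged into one kernel-verified Lean document; each statement's English description precedes it below -/
import Mathlib

section
/- Let E be a real Banach space, u ∈ E, and v_A(u), and let v_B : E → E. Suppose: (i) a : ℝ → E is a curve with a(0) = u that is differentiable at 0 with a'(0) = v_A(u); (ii) there exist r > 0 and a map R : ℝ × E → E such that for all x with ‖x − u‖ ≤ r and all h, Φ_B(h, x) = x + h · v_B(x) + R(h, x), where sup_{‖x−u‖ ≤ r} ‖R(h, x)‖ / |h| → 0 as h → 0; and (iii) v_B is continuous at u. Then the split-step curve h ↦ Φ_B(h, a(h)) is differentiable at h = 0 with derivative v_A(u) + v_B(u). -/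
/-- Multiplying by the scalar variable turns continuity at `0` into differentiability at `0`. -/
theorem ContinuousAt.hasDerivAt_id_smul_zero {E : Type*} [NormedAddCommGroup E] [NormedSpace ℝ E]
    {f : ℝ → E} (hf : ContinuousAt f 0) : HasDerivAt (fun h : ℝ => h • f h) (f 0) 0 := by
  rw [hasDerivAt_iff_tendsto_slope]
  refine (hf.tendsto.mono_left nhdsWithin_le_nhds).congr' ?_
  filter_upwards [self_mem_nhdsWithin] with h hh
  have hh0 : h ≠ 0 := hh
  simp [slope_def_module, smul_smul, hh0]

/-- State-level consistency of one Lie–Trotter split step: if `a` is a curve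
through `u` with `a'(0) = v_A(u)`, and the substep flow `Φ_B` admits a
first-order expansion `Φ_B (h, x) = x + h • v_B x + R (h, x)` uniformly for `x`
near `u`, with `v_B` continuous at `u`, then `h ↦ Φ_B (h, a h)` is
differentiable at `0` with derivative `v_A(u) + v_B(u)`. -/
theorem lie_trotter_split_step_state_derivative
    {E : Type*} [NormedAddCommGroup E] [NormedSpace ℝ E] [CompleteSpace E]
    (u : E) (vAu : E) (vB : E → E)
    (a : ℝ → E) (ha0 : a 0 = u) (ha : HasDerivAt a vAu 0)
    (ΦB : ℝ × E → E) (R : ℝ × E → E) (r : ℝ) (hr : 0 < r)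
    (hexp : ∀ (h : ℝ) (x : E), ‖x - u‖ ≤ r → ΦB (h, x) = x + h • vB x + R (h, x))
    (hR : ∀ ε > (0 : ℝ), ∃ δ > (0 : ℝ), ∀ h : ℝ, |h| < δ →
      ∀ x : E, ‖x - u‖ ≤ r → ‖R (h, x)‖ ≤ ε * |h|)
    (hcont : ContinuousAt vB u) :
    HasDerivAt (fun h : ℝ => ΦB (h, a h)) (vAu + vB u) 0 := by
  have hclose : ∀ᶠ h in nhds (0 : ℝ), ‖a h - u‖ ≤ r := by
    have hmem := ha.continuousAt.eventually (Metric.closedBall_mem_nhds (a 0) hr)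
    simpa [ha0, dist_eq_norm] using hmem
  have hvB : HasDerivAt (fun h : ℝ => h • vB (a h)) (vB u) 0 := by
    have hcomp : ContinuousAt (fun h : ℝ => vB (a h)) 0 :=
      ContinuousAt.comp (g := vB) (by rwa [ha0]) ha.continuousAt
    simpa [ha0] using hcomp.hasDerivAt_id_smul_zero
  have hR0 : R (0, a 0) = 0 := by
    obtain ⟨δ, hδ, hb⟩ := hR 1 one_pos
    simpa using hb 0 (by simpa using hδ) (a 0) (by simpa [ha0] using hr.le)
  have hrem : HasDerivAt (fun h : ℝ => R (h, a h)) 0 0 := by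
    rw [hasDerivAt_iff_isLittleO, Asymptotics.isLittleO_iff]
    intro ε hε
    obtain ⟨δ, hδ, hb⟩ := hR ε hε
    filter_upwards [hclose, Metric.ball_mem_nhds (0 : ℝ) hδ] with h hh hhδ
    simpa [hR0] using hb h (by simpa using hhδ) (a h) hh
  have hsum := (ha.add hvB).add hrem
  rw [add_zero] at hsum
  refine hsum.congr_of_eventuallyEq ?_
  filter_upwards [hclose] with h hh
  exact hexp h (a h) hh
end

section
/- Let E be a real Banach space, u ∈ E, and let v_A(u) ∈ E and v_B : E → E. Suppose: (i) a : ℝ → E is a curve with a(0) = u that is differentiable at 0 with a'(0) = v_A(u); (ii) there exist r > 0 and R : ℝ × E → E such that Φ_B(h, x) = x + h · v_B(x) + R(h, x) for all ‖x − u‖ ≤ r, with sup_{‖x−u‖ ≤ r} ‖R(h, x)‖ / |h| → 0 as h → 0; (iii) v_B is continuous at u; and (iv) φ : E → ℝ is Fréchet differentiable at u with derivative Dφ(u). Then lim_{h → 0} ( φ(Φ_B(h, a(h))) − φ(u) ) / h = Dφ(u)( v_A(u) + v_B(u) ). -/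
open Topology

/-- Multiplying a curve that is merely continuous at `0` by the time parameter makes it
differentiable there. -/
theorem hasDerivAt_smul_of_continuousAt_zero {E : Type*} [NormedAddCommGroup E] [NormedSpace ℝ E]
    {w : ℝ → E} (hw : ContinuousAt w 0) : HasDerivAt (fun h : ℝ => h • w h) (w 0) 0 := by
  rw [hasDerivAt_iff_tendsto_slope]
  refine (hw.tendsto.mono_left nhdsWithin_le_nhds).congr' ?_
  filter_upwards [self_mem_nhdsWithin] with h hh
  simp [slope_def_module, inv_smul_smul₀ (show h ≠ 0 from hh)]

/-- A split step whose second substep is consistent, uniformly near the base point, moves with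
the sum of the two component velocities. -/
theorem hasDerivAt_split_step {E : Type*} [NormedAddCommGroup E] [NormedSpace ℝ E]
    {u vAu : E} {vB : E → E} {a : ℝ → E} (ha0 : a 0 = u) (ha : HasDerivAt a vAu 0)
    {ΦB R : ℝ × E → E} {r : ℝ} (hr : 0 < r)
    (hexp : ∀ (h : ℝ) (x : E), ‖x - u‖ ≤ r → ΦB (h, x) = x + h • vB x + R (h, x))
    (hR : ∀ ε > (0 : ℝ), ∃ δ > (0 : ℝ), ∀ h : ℝ, |h| < δ →
      ∀ x : E, ‖x - u‖ ≤ r → ‖R (h, x)‖ ≤ ε * |h|)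
    (hcont : ContinuousAt vB u) :
    HasDerivAt (fun h => ΦB (h, a h)) (vAu + vB u) 0 := by
  have hnear : ∀ᶠ h in 𝓝 (0 : ℝ), ‖a h - u‖ ≤ r := by
    filter_upwards [ha.continuousAt.tendsto (Metric.closedBall_mem_nhds (a 0) hr)] with h hh
    simpa [ha0, dist_eq_norm] using hh
  have hR0 : R (0, a 0) = 0 := by
    obtain ⟨δ, hδ, hb⟩ := hR 1 one_pos
    simpa using hb 0 (by simpa using hδ) (a 0) (by simpa [ha0] using hr.le)
  have hrem : HasDerivAt (fun h => R (h, a h)) 0 0 := by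
    rw [hasDerivAt_iff_isLittleO, Asymptotics.isLittleO_iff]
    intro ε hε
    obtain ⟨δ, hδ, hb⟩ := hR ε hε
    filter_upwards [hnear, Metric.ball_mem_nhds (0 : ℝ) hδ] with h hh hhδ
    simpa [hR0] using hb h (by simpa using hhδ) (a h) hh
  have hB : HasDerivAt (fun h : ℝ => h • vB (a h)) (vB u) 0 := by
    have hw : ContinuousAt (fun h => vB (a h)) 0 :=
      ContinuousAt.comp (by rwa [ha0]) ha.continuousAt
    simpa [ha0] using hasDerivAt_smul_of_continuousAt_zero hw
  have hsum : HasDerivAt (fun h => a h + h • vB (a h) + R (h, a h)) (vAu + vB u) 0 := by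
    simpa using (ha.fun_add hB).fun_add hrem
  exact hsum.congr_of_eventuallyEq (hnear.mono fun h hh => hexp h (a h) hh)

/-- Consistency of the Lie–Trotter split propagator on observables: under the
split-step hypotheses, for `φ` Fréchet differentiable at `u`, the difference
quotient `(φ(Φ_B(h, a(h))) − φ(u)) / h` converges, as `h → 0`, to the Liouville
operator value `Dφ(u)(v_A(u) + v_B(u))`. -/
theorem lie_trotter_split_step_observable_consistency
    {E : Type*} [NormedAddCommGroup E] [NormedSpace ℝ E] [CompleteSpace E]
    (u : E) (vAu : E) (vB : E → E)
    (a : ℝ → E) (ha0 : a 0 = u) (ha : HasDerivAt a vAu 0)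
    (ΦB : ℝ × E → E) (R : ℝ × E → E) (r : ℝ) (hr : 0 < r)
    (hexp : ∀ (h : ℝ) (x : E), ‖x - u‖ ≤ r → ΦB (h, x) = x + h • vB x + R (h, x))
    (hR : ∀ ε > (0 : ℝ), ∃ δ > (0 : ℝ), ∀ h : ℝ, |h| < δ →
      ∀ x : E, ‖x - u‖ ≤ r → ‖R (h, x)‖ ≤ ε * |h|)
    (hcont : ContinuousAt vB u)
    (φ : E → ℝ) (Dφ : E →L[ℝ] ℝ) (hφ : HasFDerivAt φ Dφ u) :
    Filter.Tendsto (fun h : ℝ => (φ (ΦB (h, a h)) - φ u) / h)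
      (𝓝[≠] (0 : ℝ)) (𝓝 (Dφ (vAu + vB u))) := by
  have hstart : ΦB (0, a 0) = u := by
    obtain ⟨δ, hδ, hb⟩ := hR 1 one_pos
    have hu : ‖u - u‖ ≤ r := by simpa using hr.le
    have hR0 : R (0, u) = 0 := by simpa using hb 0 (by simpa using hδ) u hu
    simp [ha0, hexp 0 u hu, hR0]
  have hstep := hasDerivAt_split_step ha0 ha hr hexp hR hcont
  have hcomp : HasDerivAt (fun h => φ (ΦB (h, a h))) (Dφ (vAu + vB u)) 0 :=
    HasFDerivAt.comp_hasDerivAt (f := fun h => ΦB (h, a h)) 0 (by rwa [hstart]) hstep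
  rw [hasDerivAt_iff_tendsto_slope] at hcomp
  refine hcomp.congr fun h => ?_
  rw [slope_def_field, hstart, sub_zero]
end

section
/- Let E be a real Banach space with its Borel σ-algebra, L ≥ 0, M ≥ 0, ε ≥ 0, N a positive integer, τ = 1/N, t_k = k τ. Let v, v̂ : [0,1] × E → E be such that v(t, ·) is L-Lipschitz for every t, ‖v(t, z) − v̂(t, z)‖ ≤ ε for all (t, z), and v̂(t_k, ·) is measurable for each k. Suppose Φ : E → E is a map such that for every u ∈ E there is a twice differentiable curve x_u : [0,1] → E with x_u(0) = u, x_u'(t) = v(t, x_u(t)), ‖x_u''(t)‖ ≤ M for all t, and Φ(u) = x_u(1); assume Φ is measurable. Define Ψ : E → E by the Euler recursion y₀(u) = u, y_{k+1}(u) = y_k(u) + τ v̂(t_k, y_k(u)), Ψ(u) = y_N(u). Then for every probability measure μ₀ on E and every bounded 1-Lipschitz φ : E → ℝ, | ∫ φ d(Ψ_#μ₀) − ∫ φ d(Φ_#μ₀) | ≤ ((M/2) τ + ε) · (e^{L} − 1)/L (interpreting (e^L − 1)/L as 1 when L = 0). -/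
open MeasureTheory

/-- First-order Taylor remainder for a curve whose derivative has derivative bounded by `M`. -/
theorem norm_sub_sub_smul_le_of_norm_second_deriv_le
    {E : Type*} [NormedAddCommGroup E] [NormedSpace ℝ E] {x x' x'' : ℝ → E} {M a b : ℝ}
    (hab : a ≤ b) (hx : ∀ t ∈ Set.Icc a b, HasDerivAt x (x' t) t)
    (hx' : ∀ t ∈ Set.Icc a b, HasDerivAt x' (x'' t) t) (hM : ∀ t ∈ Set.Icc a b, ‖x'' t‖ ≤ M) :
    ‖x b - x a - (b - a) • x' a‖ ≤ M / 2 * (b - a) ^ 2 := by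
  have hlip : ∀ t ∈ Set.Icc a b, ‖x' t - x' a‖ ≤ M * (t - a) :=
    norm_image_sub_le_of_norm_deriv_le_segment' (fun t ht => (hx' t ht).hasDerivWithinAt)
      fun t ht => hM t (Set.Ico_subset_Icc_self ht)
  have hrem : ∀ t ∈ Set.Icc a b,
      HasDerivAt (fun s => x s - x a - (s - a) • x' a) (x' t - x' a) t := fun t ht =>
    (((hx t ht).sub_const (x a)).sub
      (((hasDerivAt_id t).sub_const a).smul_const (x' a))).congr_deriv (by simp)
  have hbound : ∀ t, HasDerivAt (fun s => M / 2 * (s - a) ^ 2) (M * (t - a)) t := fun t => by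
    refine ((((hasDerivAt_id t).sub_const a).pow 2).const_mul (M / 2)).congr_deriv ?_
    simp only [id_eq]
    ring
  exact image_norm_le_of_norm_deriv_right_le_deriv_boundary
    (fun t ht => (hrem t ht).continuousAt.continuousWithinAt)
    (fun t ht => (hrem t (Set.Ico_subset_Icc_self ht)).hasDerivWithinAt) (by simp) hbound
    (fun t ht => hlip t (Set.Ico_subset_Icc_self ht)) (Set.right_mem_Icc.2 hab)

/-- Discrete Grönwall inequality for a recursion with step size `τ`, started at zero. -/
theorem discrete_gronwall_le_exp {e : ℕ → ℝ} {L τ C : ℝ} {N : ℕ}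
    (hL : 0 ≤ L) (hτ : 0 ≤ τ) (hC : 0 ≤ C) (h0 : e 0 ≤ 0)
    (hstep : ∀ k < N, e (k + 1) ≤ (1 + L * τ) * e k + τ * C) :
    e N ≤ C * (if L = 0 then N * τ else (Real.exp (L * (N * τ)) - 1) / L) := by
  suffices h : ∀ k ≤ N, e k ≤ C * (if L = 0 then k * τ else (Real.exp (L * (k * τ)) - 1) / L) from
    h N le_rfl
  intro k
  induction k with
  | zero => simpa using h0
  | succ k ih =>
    intro hk
    have hih := ih (by omega)
    refine (hstep k hk).trans ?_
    split_ifs at hih ⊢ with hL0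
    · subst hL0
      push_cast
      linarith
    · have hLpos : 0 < L := lt_of_le_of_ne hL (Ne.symm hL0)
      have hexp : (1 + L * τ) * Real.exp (L * (k * τ)) ≤ Real.exp (L * ((k + 1 : ℕ) * τ)) := by
        have hsplit : L * ((k + 1 : ℕ) * τ) = L * τ + L * (k * τ) := by push_cast; ring
        rw [hsplit, Real.exp_add]
        gcongr
        linarith [Real.add_one_le_exp (L * τ)]
      calc (1 + L * τ) * e k + τ * C
          ≤ (1 + L * τ) * (C * ((Real.exp (L * (k * τ)) - 1) / L)) + τ * C := by gcongr
        _ = C * (((1 + L * τ) * Real.exp (L * (k * τ)) - 1) / L) := by field_simp; ring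
        _ ≤ _ := by gcongr

/-- Pushforwards under maps at uniform distance at most `B` are within `B` of each other
when tested against bounded 1-Lipschitz functions. -/
theorem abs_integral_map_sub_integral_map_le
    {Ω E : Type*} [MeasurableSpace Ω] [PseudoMetricSpace E] [MeasurableSpace E] [BorelSpace E]
    {μ : Measure Ω} [IsProbabilityMeasure μ] {f g : Ω → E} (hf : Measurable f) (hg : Measurable g)
    {B : ℝ} (hfg : ∀ u, dist (f u) (g u) ≤ B) {φ : E → ℝ} (hφ : LipschitzWith 1 φ)
    (hbdd : ∃ C : ℝ, ∀ u, |φ u| ≤ C) :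
    |(∫ z, φ z ∂(μ.map f)) - ∫ z, φ z ∂(μ.map g)| ≤ B := by
  obtain ⟨C, hC⟩ := hbdd
  have hmeas : Measurable φ := hφ.continuous.measurable
  have hint : ∀ {h : Ω → E}, Measurable h → Integrable (fun u => φ (h u)) μ := fun hh =>
    .of_bound (hmeas.comp hh).aestronglyMeasurable C (.of_forall fun u => hC _)
  rw [integral_map hf.aemeasurable hmeas.aestronglyMeasurable,
    integral_map hg.aemeasurable hmeas.aestronglyMeasurable,
    ← integral_sub (hint hf) (hint hg), ← Real.norm_eq_abs]
  have hle : ∀ u, ‖φ (f u) - φ (g u)‖ ≤ B := fun u => by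
    rw [← dist_eq_norm]
    simpa using (hφ.dist_le_mul (f u) (g u)).trans (by simpa using hfg u)
  simpa using norm_integral_le_of_norm_le_const (μ := μ) (.of_forall hle)

/-- Measure-level error bound for the learned Euler/Lie–Trotter sampling map
(the paper's main theorem, in Kantorovich dual form): if `Φ` is the exact
time-1 flow map of the `L`-Lipschitz true field `v` (along curves with second
derivative bounded by `M`), and `Ψ` is the `N`-step Euler map of the learned
field `v̂` with `‖v − v̂‖ ≤ ε`, then for every probability measure `μ₀` and
every bounded 1-Lipschitz observable `φ`,
`|∫ φ d(Ψ_#μ₀) − ∫ φ d(Φ_#μ₀)| ≤ ((M/2) τ + ε) (e^L − 1)/L`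
(read as `(M/2) τ + ε` when `L = 0`). -/
theorem learned_sampling_wasserstein_dual_error_bound
    {E : Type*} [NormedAddCommGroup E] [NormedSpace ℝ E] [CompleteSpace E]
    [MeasurableSpace E] [BorelSpace E]
    (L M ε : ℝ) (hL : 0 ≤ L) (hM : 0 ≤ M) (hε : 0 ≤ ε)
    (N : ℕ) (hN : 0 < N) (τ : ℝ) (hτ : τ = 1 / (N : ℝ))
    (v vhat : ℝ × E → E)
    (hv : ∀ t : ℝ, ∀ z w : E, ‖v (t, z) - v (t, w)‖ ≤ L * ‖z - w‖)
    (hclose : ∀ (t : ℝ) (z : E), ‖v (t, z) - vhat (t, z)‖ ≤ ε)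
    (hvhatmeas : ∀ k < N, Measurable fun z : E => vhat ((k : ℝ) * τ, z))
    (Φ : E → E) (hΦmeas : Measurable Φ)
    (hΦ : ∀ u : E, ∃ x : ℝ → E, x 0 = u ∧
      (∀ t ∈ Set.Icc (0 : ℝ) 1, HasDerivAt x (v (t, x t)) t) ∧
      (∃ x'' : ℝ → E,
        (∀ t ∈ Set.Icc (0 : ℝ) 1, HasDerivAt (fun s => v (s, x s)) (x'' t) t) ∧
        ∀ t ∈ Set.Icc (0 : ℝ) 1, ‖x'' t‖ ≤ M) ∧
      Φ u = x 1)
    (y : ℕ → E → E) (hy0 : ∀ u : E, y 0 u = u)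
    (hyk : ∀ k < N, ∀ u : E, y (k + 1) u = y k u + τ • vhat ((k : ℝ) * τ, y k u))
    (Ψ : E → E) (hΨ : ∀ u : E, Ψ u = y N u) (hΨmeas : Measurable Ψ) :
    ∀ μ₀ : Measure E, IsProbabilityMeasure μ₀ →
      ∀ φ : E → ℝ, LipschitzWith 1 φ → (∃ C : ℝ, ∀ u : E, |φ u| ≤ C) →
        |(∫ z, φ z ∂(μ₀.map Ψ)) - ∫ z, φ z ∂(μ₀.map Φ)| ≤
          ((M / 2) * τ + ε) * (if L = 0 then 1 else (Real.exp L - 1) / L) := by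
  intro μ₀ _ φ hφ hbdd
  refine abs_integral_map_sub_integral_map_le hΨmeas hΦmeas (fun u => ?_) hφ hbdd
  obtain ⟨x, hx0, hx, ⟨x'', hx', hxM⟩, hΦu⟩ := hΦ u
  have hNpos : (0 : ℝ) < N := by exact_mod_cast hN
  have hτ0 : 0 ≤ τ := by rw [hτ]; positivity
  have hNτ : (N : ℝ) * τ = 1 := by rw [hτ]; field_simp
  have hgron := discrete_gronwall_le_exp (e := fun k => ‖y k u - x (k * τ)‖) (N := N) hL hτ0
    (C := M / 2 * τ + ε) (by positivity) (by simp [hy0, hx0]) fun k hk => ?_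
  · simpa [hNτ, hΨ, hΦu, dist_eq_norm] using hgron
  have hsub : Set.Icc (k * τ) ((k + 1 : ℕ) * τ) ⊆ Set.Icc 0 1 := by
    refine Set.Icc_subset_Icc (by positivity) (hNτ ▸ ?_)
    gcongr
    exact hk
  have htaylor := norm_sub_sub_smul_le_of_norm_second_deriv_le (x' := fun s => v (s, x s))
    (by push_cast; linarith) (fun t ht => hx t (hsub ht)) (fun t ht => hx' t (hsub ht))
    (fun t ht => hxM t (hsub ht))
  have hlen : ((k + 1 : ℕ) : ℝ) * τ - k * τ = τ := by push_cast; ring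
  rw [hlen] at htaylor
  set t := (k : ℝ) * τ
  set r := x ((k + 1 : ℕ) * τ) - x t - τ • v (t, x t) with hr
  have hsplit : y (k + 1) u - x ((k + 1 : ℕ) * τ) = (y k u - x t)
      + τ • (v (t, y k u) - v (t, x t)) - τ • (v (t, y k u) - vhat (t, y k u)) - r := by
    rw [hyk k hk, hr]
    module
  calc ‖y (k + 1) u - x ((k + 1 : ℕ) * τ)‖
      ≤ ‖y k u - x t‖ + ‖τ • (v (t, y k u) - v (t, x t))‖
        + ‖τ • (v (t, y k u) - vhat (t, y k u))‖ + ‖r‖ := by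
        rw [hsplit]
        exact norm_sub_le_of_le
          (norm_sub_le_of_le (norm_add_le _ _) le_rfl) le_rfl
    _ ≤ ‖y k u - x t‖ + τ * (L * ‖y k u - x t‖) + τ * ε + M / 2 * τ ^ 2 := by
        simp only [norm_smul, Real.norm_of_nonneg hτ0]
        gcongr
        · exact hv _ _ _
        · exact hclose _ _
    _ = (1 + L * τ) * ‖y k u - x t‖ + τ * (M / 2 * τ + ε) := by ring
end
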